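/- Let G = (V, E) be a finite directed graph, A ⊆ V a nonempty anchor set, and SRC : ℕ → Set V with SRC 0 = A and SRC (l+1) = successor set of SRC l. Define spd : ℕ → V → ℕ by spd 0 v = 0 and, for l ≥ 1, spd l v = spd (l-1) v if spd (l-1) v > 0 or v has no in-neighbor in SRC (l-1), and spd l v = l if spd (l-1) v = 0 and v has some in-neighbor in SRC (l-1). Then for every L ∈ ℕ and every v ∈ V with 1 ≤ d(v, A) ≤ L, one has spd L v = d(v, A). Consequently, the first coordinate of the GIR state (spd L v, L) recovers d(v, A) for all non-anchor nodes within propagation depth L, so this GIR construction is {A}-position-aware on such nodes. -/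

import Mathlib

/-- A walk of length `l` from `u` to `v` in the directed graph with edge relation `E`:
a sequence `u = w₀, w₁, …, w_l = v` with `E w_{i-1} w_i` for all `1 ≤ i ≤ l`. -/
def IsWalk {V : Type*} (E : V → V → Prop) : ℕ → V → V → Prop
  | 0, u, v => u = v
  | l + 1, u, v => ∃ w, IsWalk E l u w ∧ E w v

/-- The anchor distance `d(v, A) ∈ ℕ∞`: the least `l` such that there is a walk of
length `l` from some `a ∈ A` to `v`, and `⊤` if no such walk exists. -/
noncomputable def anchorDist {V : Type*} (E : V → V → Prop) (A : Set V) (v : V) : ℕ∞ :=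
  ⨅ (l : ℕ) (_ : ∃ a ∈ A, IsWalk E l a v), (l : ℕ∞)

/-- The source sets: `src 0 = A` and `src (l+1)` is the successor set of `src l`. -/
def src {V : Type*} (E : V → V → Prop) (A : Set V) : ℕ → Set V
  | 0 => A
  | l + 1 => {v | ∃ u ∈ src E A l, E u v}

theorem mem_src_iff {V : Type*} (E : V → V → Prop) (A : Set V) (l : ℕ) (v : V) :
    v ∈ src E A l ↔ ∃ a ∈ A, IsWalk E l a v := by
  induction l generalizing v with
  | zero => simp [src, IsWalk]
  | succ l ih =>
    simp only [src, IsWalk, Set.mem_ofPred_eq, ih]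
    constructor
    · rintro ⟨u, ⟨a, ha, hw⟩, hu⟩
      exact ⟨a, ha, u, hw, hu⟩
    · rintro ⟨a, ha, u, hw, hu⟩
      exact ⟨u, ⟨a, ha, hw⟩, hu⟩

theorem anchorDist_le_of_mem_src {V : Type*} {E : V → V → Prop} {A : Set V} {l : ℕ} {v : V}
    (h : v ∈ src E A l) : anchorDist E A v ≤ l :=
  iInf₂_le l ((mem_src_iff E A l v).1 h)

theorem mem_src_of_anchorDist_eq {V : Type*} {E : V → V → Prop} {A : Set V} {n : ℕ} {v : V}
    (h : anchorDist E A v = n) : v ∈ src E A n := by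
  by_contra hn
  have hle : ((n + 1 : ℕ) : ℕ∞) ≤ anchorDist E A v := by
    refine le_iInf₂ fun l hl => ?_
    have hnl : (n : ℕ∞) ≤ l := h ▸ iInf₂_le l hl
    have hne : l ≠ n := by
      rintro rfl
      exact hn ((mem_src_iff E A l v).2 hl)
    norm_cast at hnl ⊢
    omega
  rw [h] at hle
  norm_cast at hle
  omega

/-- The first layer `n ≥ 1` at which `v` is a source is the value that `spd` records at `v`. -/
theorem spd_eq_ite_of_first_mem_src {V : Type*} {E : V → V → Prop} {A : Set V}
    {spd : ℕ → V → ℕ}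
    (hspd0 : ∀ v : V, spd 0 v = 0)
    (hspd : ∀ (l : ℕ) (v : V),
      (spd l v = 0 ∧ (∃ u ∈ src E A l, E u v) → spd (l + 1) v = l + 1) ∧
      (¬(spd l v = 0 ∧ (∃ u ∈ src E A l, E u v)) → spd (l + 1) v = spd l v))
    {n : ℕ} {v : V} (hn : 1 ≤ n) (hv : v ∈ src E A n) (hlt : ∀ m < n, v ∉ src E A m) (l : ℕ) :
    spd l v = if l < n then 0 else n := by
  induction l with
  | zero => rw [hspd0, if_pos (by omega)]
  | succ l ih =>
    obtain ⟨hset, hkeep⟩ := hspd l v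
    rcases lt_trichotomy (l + 1) n with h | h | h
    · rw [hkeep fun hu => hlt _ h hu.2, ih, if_pos (by omega), if_pos h]
    · subst h
      rw [hset ⟨by rw [ih, if_pos (by omega)], hv⟩, if_neg (by omega)]
    · rw [if_neg (by omega)] at ih
      rw [hkeep fun hu => by omega, ih, if_neg (by omega)]

/-- The GIR shortest-path-distance update `spd` (which records the
current layer index the first time a message from the anchor propagation reaches a node,
and keeps it fixed afterwards) recovers the anchor distance: for every `L` and every `v`
with `1 ≤ d(v, A) ≤ L`, we have `spd L v = d(v, A)`. Consequently, the first coordinate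
of the GIR state `(spd L v, L)` recovers `d(v, A)` on such nodes, so this GIR
construction is `{A}`-position-aware on them. -/
theorem gir_spd_position_aware {V : Type*} [Fintype V]
    (E : V → V → Prop) (A : Set V) (hA : A.Nonempty)
    (spd : ℕ → V → ℕ)
    (hspd0 : ∀ v : V, spd 0 v = 0)
    (hspd : ∀ (l : ℕ) (v : V),
      (spd l v = 0 ∧ (∃ u ∈ src E A l, E u v) → spd (l + 1) v = l + 1) ∧
      (¬(spd l v = 0 ∧ (∃ u ∈ src E A l, E u v)) → spd (l + 1) v = spd l v)) :
    (∀ (L : ℕ) (v : V),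
        1 ≤ anchorDist E A v → anchorDist E A v ≤ (L : ℕ∞) →
        (spd L v : ℕ∞) = anchorDist E A v) ∧
    (∀ L : ℕ, ∃ g : ℕ × ℕ → ℕ∞, ∀ v : V,
        1 ≤ anchorDist E A v → anchorDist E A v ≤ (L : ℕ∞) →
        g (spd L v, L) = anchorDist E A v) := by
  have key : ∀ (L : ℕ) (v : V), 1 ≤ anchorDist E A v → anchorDist E A v ≤ (L : ℕ∞) →
      (spd L v : ℕ∞) = anchorDist E A v := by
    intro L v h1 hL
    obtain ⟨n, hn⟩ := ENat.ne_top_iff_exists.1 (ne_top_of_le_ne_top (ENat.natCast_ne_top L) hL)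
    have hlt : ∀ m < n, v ∉ src E A m := by
      intro m hm hv
      have hle := anchorDist_le_of_mem_src hv
      rw [← hn] at hle
      norm_cast at hle
      omega
    have hv := mem_src_of_anchorDist_eq hn.symm
    rw [← hn] at h1 hL ⊢
    norm_cast at h1 hL ⊢
    rw [spd_eq_ite_of_first_mem_src hspd0 hspd h1 hv hlt, if_neg (by omega)]
  exact ⟨key, fun L => ⟨fun p => p.1, key L⟩⟩
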